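/- arXiv:1909.10645 — 2 statements merged into one kernel-verified Lean document; each statement's English description precedes it below -/
import Mathlib

section
/- An allocation rule x is symmetric, weakly budget-balanced, sybil-proof, and strongly collusion-proof under proportional sharing if and only if x is a generalized proportional allocation rule, i.e., there exists a nondecreasing function c : ℕ → [0,1] such that x_i(h) = c(∑_{j=1}^n h_j) · h_i / (∑_{j=1}^n h_j) for every configuration h of length n and every i. -/
/-- An *allocation rule* maps every configuration (a finite tuple of positive
integer hash rates) of every length to a tuple of nonnegative real
(expected) rewards of the same length. -/
structure AllocRule where
  alloc : ∀ {n : ℕ}, (Fin n → ℕ+) → Fin n → ℝ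
  nonneg : ∀ {n : ℕ} (h : Fin n → ℕ+) (i : Fin n), 0 ≤ alloc h i

/-- A1: symmetry: `x (π h) = π (x h)` for every permutation `π`. -/
def SymmetricRule (x : AllocRule) : Prop :=
  ∀ {n : ℕ}, 0 < n → ∀ (h : Fin n → ℕ+) (π : Equiv.Perm (Fin n)) (i : Fin n),
    x.alloc (h ∘ π) i = x.alloc h (π i)

/-- A2a: strong budget balance. -/
def StronglyBudgetBalanced (x : AllocRule) : Prop :=
  ∀ {n : ℕ}, 0 < n → ∀ h : Fin n → ℕ+, ∑ i, x.alloc h i = 1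

/-- A2b: weak budget balance. -/
def WeaklyBudgetBalanced (x : AllocRule) : Prop :=
  ∀ {n : ℕ}, 0 < n → ∀ h : Fin n → ℕ+, ∑ i, x.alloc h i ≤ 1

/-- `h'` (whose set of new-entry positions is `S`) is obtained from `h` by
replacing the single entry at index `i` with a finite tuple of positive
integers summing to at most `h i`, all other entries unchanged. -/
def IsSybilSplit {n m : ℕ} (h : Fin n → ℕ+) (i : Fin n)
    (h' : Fin m → ℕ+) (S : Finset (Fin m)) : Prop :=
  S.Nonempty ∧
  ∃ e : {j : Fin n // j ≠ i} ↪ Fin m,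
    (∀ j, h' (e j) = h j.1) ∧
    (∀ k : Fin m, k ∈ S ↔ k ∉ Set.range e) ∧
    (∑ k ∈ S, (h' k : ℕ)) ≤ (h i : ℕ)

/-- A3: sybil-proofness. -/
def SybilProof (x : AllocRule) : Prop :=
  ∀ {n m : ℕ}, 0 < n →
    ∀ (h : Fin n → ℕ+) (i : Fin n) (h' : Fin m → ℕ+) (S : Finset (Fin m)),
      IsSybilSplit h i h' S → ∑ j ∈ S, x.alloc h' j ≤ x.alloc h i

/-- `h'` (with merged-miner position `istar`) is obtained from `h` by
replacing the (nonempty) set `T` of miners with a single new miner whose hash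
rate is at most the total hash rate of `T`, all other entries unchanged. -/
def IsMerge {n m : ℕ} (h : Fin n → ℕ+) (T : Finset (Fin n))
    (h' : Fin m → ℕ+) (istar : Fin m) : Prop :=
  T.Nonempty ∧
  ∃ e : {j : Fin n // j ∉ T} ↪ Fin m,
    (∀ j, h' (e j) = h j.1) ∧
    (∀ k : Fin m, k = istar ↔ k ∉ Set.range e) ∧
    (h' istar : ℕ) ≤ ∑ j ∈ T, (h j : ℕ)

/-- A4a: collusion-proofness under arbitrary reward sharing. -/
def CollusionProofArbitrary (x : AllocRule) : Prop :=
  ∀ {n m : ℕ}, 0 < n →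
    ∀ (h : Fin n → ℕ+) (T : Finset (Fin n)) (h' : Fin m → ℕ+) (istar : Fin m),
      IsMerge h T h' istar → x.alloc h' istar ≤ ∑ j ∈ T, x.alloc h j

/-- A4b: strong collusion-proofness under proportional sharing. -/
def StronglyCollusionProof (x : AllocRule) : Prop :=
  ∀ {n m : ℕ}, 0 < n →
    ∀ (h : Fin n → ℕ+) (T : Finset (Fin n)) (h' : Fin m → ℕ+) (istar : Fin m),
      IsMerge h T h' istar →
      (∃ i ∈ T, x.alloc h i <
        x.alloc h' istar * (((h i : ℕ) : ℝ) / ∑ j ∈ T, ((h j : ℕ) : ℝ))) →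
      ∃ l ∈ T, x.alloc h' istar * (((h l : ℕ) : ℝ) / ∑ j ∈ T, ((h j : ℕ) : ℝ))
        < x.alloc h l

/-- A4c: weak collusion-proofness under proportional sharing. -/
def WeaklyCollusionProof (x : AllocRule) : Prop :=
  ∀ {n m : ℕ}, 0 < n →
    ∀ (h : Fin n → ℕ+) (T : Finset (Fin n)) (h' : Fin m → ℕ+) (istar : Fin m),
      IsMerge h T h' istar →
      ∃ i ∈ T, x.alloc h' istar * (((h i : ℕ) : ℝ) / ∑ j ∈ T, ((h j : ℕ) : ℝ))
        ≤ x.alloc h i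

/-- Bitcoin's proportional allocation rule. -/
noncomputable def propRule : AllocRule where
  alloc := fun {n} h i => ((h i : ℕ) : ℝ) / ∑ j, ((h j : ℕ) : ℝ)
  nonneg := fun h i => div_nonneg (Nat.cast_nonneg _)
    (Finset.sum_nonneg fun j _ => Nat.cast_nonneg _)

/-- The total of a tuple splits along an embedding and the complement of its range. -/
lemma sum_eq_sum_compl_range_add {m : ℕ} {α : Type*} [Fintype α] (e : α ↪ Fin m)
    (f : Fin m → ℕ) (S : Finset (Fin m)) (hS : ∀ k, k ∈ S ↔ k ∉ Set.range e) :
    ∑ k, f k = ∑ k ∈ S, f k + ∑ a, f (e a) := by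
  classical
  have hc : Sᶜ = Finset.univ.map e := by
    ext k
    simp [hS k]
  rw [← Finset.sum_add_sum_compl S f, hc, Finset.sum_map]

/-- A participant with less power in a smaller total gets a smaller proportional reward. -/
lemma mul_div_add_le_mul_div_add {c : ℕ → ℝ} (hc : Monotone c) (h0 : ∀ k, 0 ≤ c k)
    {s t r : ℕ} (hst : s ≤ t) (hs : 0 < s) :
    c (s + r) * ((s : ℝ) / ((s + r : ℕ) : ℝ)) ≤ c (t + r) * ((t : ℝ) / ((t + r : ℕ) : ℝ)) := by
  refine mul_le_mul (hc (by omega)) ?_ (by positivity) (h0 _)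
  have h1 : (0 : ℝ) < ((s + r : ℕ) : ℝ) := by exact_mod_cast (by omega : 0 < s + r)
  have h2 : (0 : ℝ) < ((t + r : ℕ) : ℝ) := by exact_mod_cast (by omega : 0 < t + r)
  rw [div_le_div_iff₀ h1 h2]
  have h3 : s * (t + r) ≤ t * (s + r) := by nlinarith
  exact_mod_cast h3

/-- `x` is the generalized proportional rule with total reward function `c`. -/
def IsGenProportional (x : AllocRule) (c : ℕ → ℝ) : Prop :=
  ∀ (n : ℕ), 0 < n → ∀ (h : Fin n → ℕ+) (i : Fin n),
    x.alloc h i = c (∑ j, (h j : ℕ)) * (((h i : ℕ) : ℝ) / ∑ j, ((h j : ℕ) : ℝ))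

namespace IsGenProportional

variable {x : AllocRule} {c : ℕ → ℝ}

lemma sum_alloc (hx : IsGenProportional x c) {n : ℕ} (hn : 0 < n) (h : Fin n → ℕ+)
    (S : Finset (Fin n)) :
    ∑ i ∈ S, x.alloc h i =
      c (∑ j, (h j : ℕ)) * (((∑ i ∈ S, (h i : ℕ) : ℕ) : ℝ) / ((∑ j, (h j : ℕ) : ℕ) : ℝ)) := by
  push_cast
  rw [Finset.sum_div, Finset.mul_sum]
  exact Finset.sum_congr rfl fun i _ => hx n hn h i

lemma symmetricRule (hx : IsGenProportional x c) : SymmetricRule x := by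
  intro n hn h π i
  rw [hx n hn, hx n hn]
  simp only [Function.comp_apply]
  rw [Equiv.sum_comp π fun j => (h j : ℕ), Equiv.sum_comp π fun j => ((h j : ℕ) : ℝ)]

lemma weaklyBudgetBalanced (hx : IsGenProportional x c) (h1 : ∀ k, c k ≤ 1) :
    WeaklyBudgetBalanced x := by
  intro n hn h
  rw [hx.sum_alloc hn]
  exact mul_le_one₀ (h1 _) (by positivity) (div_self_le_one _)

lemma sybilProof (hx : IsGenProportional x c) (hc : Monotone c) (h0 : ∀ k, 0 ≤ c k) :
    SybilProof x := by
  rintro n m hn h i h' S ⟨⟨k, hk⟩, e, he, hS, hle⟩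
  have htot' := sum_eq_sum_compl_range_add e (fun k => (h' k : ℕ)) S hS
  have htot := sum_eq_sum_compl_range_add (Function.Embedding.subtype fun j => j ≠ i)
    (fun k => (h k : ℕ)) {i} (by simp)
  simp only [he] at htot'
  simp only [Finset.sum_singleton, Function.Embedding.subtype_apply] at htot
  have hpos : 0 < ∑ k ∈ S, (h' k : ℕ) := Finset.sum_pos (fun k _ => (h' k).pos) ⟨k, hk⟩
  have hi := hx.sum_alloc hn h {i}
  rw [Finset.sum_singleton, Finset.sum_singleton] at hi
  rw [hx.sum_alloc (Fin.pos k), hi, htot, htot']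
  exact mul_div_add_le_mul_div_add hc h0 hle hpos

lemma stronglyCollusionProof (hx : IsGenProportional x c) (hc : Monotone c)
    (h0 : ∀ k, 0 ≤ c k) : StronglyCollusionProof x := by
  rintro n m hn h T h' k ⟨⟨t, ht⟩, e, he, hk, hle⟩ ⟨i, hiT, hlt⟩
  exfalso
  have htot' := sum_eq_sum_compl_range_add e (fun k => (h' k : ℕ)) {k} (by simpa using hk)
  have htot := sum_eq_sum_compl_range_add (Function.Embedding.subtype fun j => j ∉ T)
    (fun k => (h k : ℕ)) T (by simp)
  simp only [he, Finset.sum_singleton] at htot'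
  simp only [Function.Embedding.subtype_apply] at htot
  have hT : 0 < ∑ k ∈ T, (h k : ℕ) := Finset.sum_pos (fun k _ => (h k).pos) ⟨t, ht⟩
  have key := mul_div_add_le_mul_div_add hc h0 (r := ∑ j : {j // j ∉ T}, (h j : ℕ)) hle (h' k).pos
  have hk := hx.sum_alloc (Fin.pos k) h' {k}
  rw [Finset.sum_singleton, Finset.sum_singleton, htot'] at hk
  rw [← htot, ← hk] at key
  have hT' : (0 : ℝ) < ∑ k ∈ T, ((h k : ℕ) : ℝ) := by exact_mod_cast hT
  have hmul := mul_le_mul_of_nonneg_right key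
    (show 0 ≤ ((h i : ℕ) : ℝ) / ∑ j ∈ T, ((h j : ℕ) : ℝ) by positivity)
  refine absurd (hlt.trans_le hmul) (not_lt_of_ge (le_of_eq ?_))
  rw [hx n hn h i]
  push_cast
  field_simp

end IsGenProportional

/-- The reward of a single miner whose hash rate is `k`. -/
noncomputable def soloReward (x : AllocRule) (k : ℕ) : ℝ :=
  if hk : 0 < k then x.alloc (fun _ : Fin 1 => ⟨k, hk⟩) 0 else 0

section Forward

variable {x : AllocRule}

lemma soloReward_nonneg (k : ℕ) : 0 ≤ soloReward x k := by
  unfold soloReward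
  split_ifs
  exacts [x.nonneg _ _, le_rfl]

lemma soloReward_le_one (hb : WeaklyBudgetBalanced x) (k : ℕ) : soloReward x k ≤ 1 := by
  unfold soloReward
  split_ifs with hk
  · simpa using hb one_pos fun _ : Fin 1 => ⟨k, hk⟩
  · exact zero_le_one

/-- A configuration of total at most `k` is a sybil split of the solo configuration `k`. -/
lemma sum_alloc_le_soloReward (hs : SybilProof x) {n k : ℕ} (hn : 0 < n) (h : Fin n → ℕ+)
    (hk : ∑ j, (h j : ℕ) ≤ k) : ∑ j, x.alloc h j ≤ soloReward x k := by
  have : NeZero n := ⟨hn.ne'⟩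
  have hk0 : 0 < k :=
    (Finset.sum_pos (fun j _ => (h j).pos) ⟨0, Finset.mem_univ _⟩).trans_le hk
  have : IsEmpty {j : Fin 1 // j ≠ 0} := ⟨fun j => j.2 (Subsingleton.elim _ _)⟩
  rw [soloReward, dif_pos hk0]
  exact hs one_pos _ 0 h Finset.univ
    ⟨⟨0, Finset.mem_univ _⟩, Function.Embedding.ofIsEmpty, fun j => isEmptyElim j, by simp, hk⟩

lemma monotone_soloReward (hs : SybilProof x) : Monotone (soloReward x) := by
  intro a b hab
  rcases Nat.eq_zero_or_pos a with rfl | ha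
  · rw [soloReward, dif_neg (lt_irrefl 0)]
    exact soloReward_nonneg b
  · have := sum_alloc_le_soloReward hs one_pos (fun _ : Fin 1 => ⟨a, ha⟩) (k := b) (by simpa)
    rw [soloReward, dif_pos ha]
    simpa using this

/-- If no miner gets more than the proportional share of the solo reward, then the allocation is
proportional, by collusion-proofness against the coalition of all miners. -/
lemma alloc_eq_of_forall_le (hc : StronglyCollusionProof x) {n : ℕ} (h : Fin n → ℕ+)
    (hle : ∀ i, x.alloc h i ≤
      soloReward x (∑ j, (h j : ℕ)) * (((h i : ℕ) : ℝ) / ∑ j, ((h j : ℕ) : ℝ))) (i : Fin n) :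
    x.alloc h i =
      soloReward x (∑ j, (h j : ℕ)) * (((h i : ℕ) : ℝ) / ∑ j, ((h j : ℕ) : ℝ)) := by
  by_contra hne
  have hk0 : 0 < ∑ j, (h j : ℕ) := Finset.sum_pos (fun j _ => (h j).pos) ⟨i, Finset.mem_univ _⟩
  have : IsEmpty {j : Fin n // j ∉ Finset.univ} := ⟨fun j => j.2 (Finset.mem_univ _)⟩
  have hlt := lt_of_le_of_ne (hle i) hne
  rw [soloReward, dif_pos hk0] at hle hlt
  obtain ⟨l, -, hl⟩ := hc (Fin.pos i) h Finset.univ (fun _ : Fin 1 => ⟨_, hk0⟩) 0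
    ⟨⟨i, Finset.mem_univ _⟩, Function.Embedding.ofIsEmpty, fun j => isEmptyElim j,
      fun k => by simp [Subsingleton.elim k 0], le_rfl⟩ ⟨i, Finset.mem_univ _, hlt⟩
  exact absurd (hle l) (not_le_of_gt hl)

/-- Miners with equal hash rates get equal rewards. -/
lemma alloc_eq_of_eq (hsym : SymmetricRule x) {n : ℕ} (h : Fin n → ℕ+) {i j : Fin n}
    (hij : h i = h j) : x.alloc h i = x.alloc h j := by
  have hswap : h ∘ Equiv.swap i j = h := by
    ext k
    rcases eq_or_ne k i with rfl | hki
    · simp [hij]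
    · rcases eq_or_ne k j with rfl | hkj
      · simp [hij]
      · simp [Equiv.swap_apply_of_ne_of_ne hki hkj]
  have := hsym (Fin.pos i) h (Equiv.swap i j) i
  rwa [hswap, Equiv.swap_apply_left] at this

/-- The configuration in which miner `i` splits off a new miner, at position `0`, of hash rate
`1`. -/
def splitUnit {n : ℕ} (h : Fin n → ℕ+) (i : Fin n) : Fin (n + 1) → ℕ+ :=
  Fin.cons 1 (Function.update h i (h i - 1))

section SplitUnit

variable {n : ℕ} (h : Fin n → ℕ+) (i : Fin n)

@[simp]
lemma splitUnit_zero : splitUnit h i 0 = 1 := rfl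

@[simp]
lemma splitUnit_succ_self : splitUnit h i i.succ = h i - 1 := by
  simp [splitUnit]

lemma splitUnit_succ_of_ne {j : Fin n} (hj : j ≠ i) : splitUnit h i j.succ = h j := by
  simp [splitUnit, hj]

lemma sum_pair_splitUnit (hi : 1 < h i) :
    ∑ k ∈ {0, i.succ}, (splitUnit h i k : ℕ) = h i := by
  rw [Finset.sum_pair (Fin.succ_ne_zero i).symm, splitUnit_zero, splitUnit_succ_self,
    ← PNat.add_coe, PNat.add_sub_of_lt hi]

/-- The embedding of the miners other than `i` into the split configuration. -/
def splitEmb : {j : Fin n // j ≠ i} ↪ Fin (n + 1) :=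
  (Function.Embedding.subtype _).trans (Fin.succEmb n)

lemma mem_pair_iff_notMem_range_splitEmb (k : Fin (n + 1)) :
    k ∈ ({0, i.succ} : Finset (Fin (n + 1))) ↔ k ∉ Set.range (splitEmb i) := by
  refine Fin.cases ?_ (fun k => ?_) k
  · simp [splitEmb]
  · simp [splitEmb]

lemma isSybilSplit_splitUnit (hi : 1 < h i) :
    IsSybilSplit h i (splitUnit h i) {0, i.succ} :=
  ⟨⟨0, by simp⟩, splitEmb i, fun j => splitUnit_succ_of_ne h i j.2,
    mem_pair_iff_notMem_range_splitEmb i, (sum_pair_splitUnit h i hi).le⟩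

lemma sum_splitUnit (hi : 1 < h i) : ∑ k, (splitUnit h i k : ℕ) = ∑ j, (h j : ℕ) := by
  rw [sum_eq_sum_compl_range_add (splitEmb i) _ _ (mem_pair_iff_notMem_range_splitEmb i),
    sum_pair_splitUnit h i hi,
    sum_eq_sum_compl_range_add (Function.Embedding.subtype fun j => j ≠ i)
      (fun k => (h k : ℕ)) {i} (by simp), Finset.sum_singleton]
  congr 1
  exact Finset.sum_congr rfl fun j _ => congrArg _ (splitUnit_succ_of_ne h i j.2)

lemma isMerge_splitUnit (hi : 1 < h i) : IsMerge (splitUnit h i) {0, i.succ} h i := by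
  have hout : ∀ k : {k : Fin (n + 1) // k ∉ ({0, i.succ} : Finset (Fin (n + 1)))},
      ∃ j : Fin n, j ≠ i ∧ j.succ = k.1 := by
    rintro ⟨k, hk⟩
    simp only [Finset.mem_insert, Finset.mem_singleton, not_or] at hk
    obtain ⟨j, rfl⟩ := Fin.exists_succ_eq.2 hk.1
    exact ⟨j, fun hj => hk.2 (congrArg _ hj), rfl⟩
  choose f hf hsucc using hout
  refine ⟨⟨0, by simp⟩, ⟨f, fun a b hab => Subtype.ext ?_⟩, fun k => ?_, fun k => ?_,
    (sum_pair_splitUnit h i hi).ge⟩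
  · rw [← hsucc a, ← hsucc b, hab]
  · rw [← hsucc k, splitUnit_succ_of_ne h i (hf k)]
    rfl
  · constructor
    · rintro rfl ⟨a, ha⟩
      exact hf a ha
    · intro hk
      by_contra hki
      exact hk ⟨⟨k.succ, by simp [hki]⟩, Fin.succ_injective _ (hsucc _)⟩

end SplitUnit

/-- If the configuration with a unit split off miner `i` pays proportionally, then the
reward of miner `i` is proportional as well. -/
lemma alloc_eq_of_splitUnit (hs : SybilProof x) (hc : StronglyCollusionProof x) {n : ℕ}
    (h : Fin n → ℕ+) (i : Fin n) (hi : 1 < h i) {a : ℝ}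
    (ha : ∀ k, x.alloc (splitUnit h i) k = a * (splitUnit h i k : ℕ)) :
    x.alloc h i = a * (h i : ℕ) := by
  have hsum : ∑ k ∈ {0, i.succ}, ((splitUnit h i k : ℕ) : ℝ) = (h i : ℕ) := by
    exact_mod_cast sum_pair_splitUnit h i hi
  have hpos : (0 : ℝ) < (h i : ℕ) := by exact_mod_cast (h i).pos
  apply le_antisymm
  · by_contra! hlt
    have hgain : ∀ k, x.alloc (splitUnit h i) k < x.alloc h i * (((splitUnit h i k : ℕ) : ℝ) /
        ∑ j ∈ {0, i.succ}, ((splitUnit h i j : ℕ) : ℝ)) := by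
      intro k
      have hk : (0 : ℝ) < (splitUnit h i k : ℕ) := by exact_mod_cast (splitUnit h i k).pos
      rw [ha, hsum, ← mul_div_assoc, lt_div_iff₀ hpos]
      nlinarith
    obtain ⟨l, -, hl⟩ := hc n.succ_pos _ _ h i (isMerge_splitUnit h i hi)
      ⟨0, by simp, hgain 0⟩
    exact lt_asymm hl (hgain l)
  · have := hs (Fin.pos i) h i _ _ (isSybilSplit_splitUnit h i hi)
    rwa [Finset.sum_congr rfl fun k _ => ha k, ← Finset.mul_sum, hsum] at this

/-- If every miner of hash rate above `1` is paid proportionally, then so is every miner. -/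
lemma alloc_eq_of_forall_one_lt (hsym : SymmetricRule x) (hs : SybilProof x)
    (hc : StronglyCollusionProof x) {n : ℕ} (h : Fin n → ℕ+)
    (hbig : ∀ i, 1 < h i → x.alloc h i =
      soloReward x (∑ j, (h j : ℕ)) * (((h i : ℕ) : ℝ) / ∑ j, ((h j : ℕ) : ℝ))) (i : Fin n) :
    x.alloc h i =
      soloReward x (∑ j, (h j : ℕ)) * (((h i : ℕ) : ℝ) / ∑ j, ((h j : ℕ) : ℝ)) := by
  refine alloc_eq_of_forall_le hc h (fun l => ?_) i
  rcases (one_le : 1 ≤ h l).eq_or_lt with hl | hl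
  · by_contra! hlt
    refine absurd (sum_alloc_le_soloReward hs (Fin.pos l) h le_rfl) (not_le_of_gt ?_)
    have hH : (0 : ℝ) < ∑ j, ((h j : ℕ) : ℝ) :=
      Finset.sum_pos (fun j _ => by exact_mod_cast (h j).pos) ⟨l, Finset.mem_univ _⟩
    calc soloReward x (∑ j, (h j : ℕ))
        = ∑ k, soloReward x (∑ j, (h j : ℕ)) * (((h k : ℕ) : ℝ) / ∑ j, ((h j : ℕ) : ℝ)) := by
          rw [← Finset.mul_sum, ← Finset.sum_div, div_self hH.ne', mul_one]
      _ < ∑ k, x.alloc h k := by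
          refine Finset.sum_lt_sum (fun k _ => ?_) ⟨l, Finset.mem_univ _, hlt⟩
          rcases (one_le : 1 ≤ h k).eq_or_lt with hk | hk
          · have hkl : h k = h l := hk.symm.trans hl
            rw [alloc_eq_of_eq hsym h hkl, hkl]
            exact hlt.le
          · exact (hbig k hk).ge
  · exact (hbig l hl).le

lemma isGenProportional_soloReward (hsym : SymmetricRule x) (hs : SybilProof x)
    (hc : StronglyCollusionProof x) : IsGenProportional x (soloReward x) := by
  suffices H : ∀ (d n : ℕ) (h : Fin n → ℕ+), ∑ j, (h j : ℕ) - n = d → ∀ i, x.alloc h i =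
      soloReward x (∑ j, (h j : ℕ)) * (((h i : ℕ) : ℝ) / ∑ j, ((h j : ℕ) : ℝ)) from
    fun n _ h i => H _ n h rfl i
  intro d
  induction d using Nat.strong_induction_on with
  | _ d ih =>
    intro n h hd
    refine alloc_eq_of_forall_one_lt hsym hs hc h fun i hi => ?_
    have hsum := sum_splitUnit h i hi
    have hsumR : ∑ k, ((splitUnit h i k : ℕ) : ℝ) = ∑ j, ((h j : ℕ) : ℝ) := by
      exact_mod_cast hsum
    have hn : n < ∑ j, (h j : ℕ) := by
      have hlt : ∑ _j : Fin n, 1 < ∑ j, (h j : ℕ) :=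
        Finset.sum_lt_sum (fun j _ => (h j).pos) ⟨i, Finset.mem_univ _, hi⟩
      simpa using hlt
    rw [alloc_eq_of_splitUnit hs hc h i hi
      (a := soloReward x (∑ j, (h j : ℕ)) / ∑ j, ((h j : ℕ) : ℝ)) fun k => ?_]
    · ring
    · rw [ih (d - 1) (by omega) (n + 1) (splitUnit h i) (by omega) k, hsum, hsumR]
      ring

end Forward

/-- Theorem 2: an allocation rule is symmetric, weakly
budget-balanced, sybil-proof, and strongly collusion-proof under proportional
sharing if and only if it is a generalized proportional allocation rule. -/
theorem generalized_proportional_characterization (x : AllocRule) :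
    (SymmetricRule x ∧ WeaklyBudgetBalanced x ∧ SybilProof x ∧
      StronglyCollusionProof x) ↔
    (∃ c : ℕ → ℝ, Monotone c ∧ (∀ k, c k ∈ Set.Icc (0 : ℝ) 1) ∧
      ∀ (n : ℕ), 0 < n → ∀ (h : Fin n → ℕ+) (i : Fin n),
        x.alloc h i = c (∑ j, (h j : ℕ)) *
          (((h i : ℕ) : ℝ) / ∑ j, ((h j : ℕ) : ℝ))) := by
  constructor
  · rintro ⟨hsym, hb, hs, hc⟩
    exact ⟨soloReward x, monotone_soloReward hs,
      fun k => ⟨soloReward_nonneg k, soloReward_le_one hb k⟩,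
      isGenProportional_soloReward hsym hs hc⟩
  · rintro ⟨c, hc, h01, hx⟩
    have hx : IsGenProportional x c := hx
    have h0 : ∀ k, 0 ≤ c k := fun k => (h01 k).1
    exact ⟨hx.symmetricRule, hx.weaklyBudgetBalanced fun k => (h01 k).2,
      hx.sybilProof hc h0, hx.stronglyCollusionProof hc h0⟩
end

section
/- The proportional allocation rule with risk-seeking miners: let 𝒰 be the set of all convex functions U : [0,1] → ℝ_{≥0} with U(1) > U(0) = 0. Then the proportional allocation rule is collusion-proof against 𝒰 under arbitrary reward sharing: for every configuration h of length n, every choice of utility functions U_1,…,U_n ∈ 𝒰, every nonempty subset T ⊆ {1,…,n}, every configuration h' obtained from h by replacing the entries indexed by T with a single new entry i* whose hash rate is at most ∑_{j∈T} h_j (all other entries unchanged), and every finite-support probability distribution over reward shares (r_i)_{i∈T} with r_i ≥ 0 and ∑_{i∈T} r_i ≤ 1 with probability one, it is NOT the case that x_{i*}(h')·E[U_i(r_i)] ≥ U_i(1)·x_i(h) for all i ∈ T with strict inequality for at least one i ∈ T (where x is the proportional rule). -/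
/-- A merge leaves the total hash rate outside the coalition unchanged. -/
theorem IsMerge.sum_eq {n m : ℕ} {h : Fin n → ℕ+} {T : Finset (Fin n)} {h' : Fin m → ℕ+}
    {istar : Fin m} (hmerge : IsMerge h T h' istar) :
    ∑ j, ((h' j : ℕ) : ℝ) = ((h' istar : ℕ) : ℝ) + ∑ j ∈ Tᶜ, ((h j : ℕ) : ℝ) := by
  obtain ⟨-, e, he, hrange, -⟩ := hmerge
  have herase : Finset.univ.erase istar = Finset.univ.map e := by
    ext k
    have := hrange k
    simp only [Finset.mem_erase, Finset.mem_univ, and_true, Finset.mem_map, true_and]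
    rw [← Set.mem_range]
    tauto
  rw [← Finset.add_sum_erase _ _ (Finset.mem_univ istar), herase, Finset.sum_map]
  simp only [he]
  rw [Finset.sum_subtype Tᶜ (p := fun j => j ∉ T) (fun _ => Finset.mem_compl)
    fun j => ((h j : ℕ) : ℝ)]

/-- The proportional rule is collusion-proof in expected rewards. -/
theorem collusionProofArbitrary_propRule : CollusionProofArbitrary propRule := by
  intro n m _ h T h' istar hmerge
  have hpos : (0 : ℝ) < ((h' istar : ℕ) : ℝ) := Nat.cast_pos.2 (h' istar).pos
  have hle : ((h' istar : ℕ) : ℝ) ≤ ∑ j ∈ T, ((h j : ℕ) : ℝ) := by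
    obtain ⟨-, e, -, -, hle⟩ := hmerge
    exact_mod_cast hle
  have hrest : 0 ≤ ∑ j ∈ Tᶜ, ((h j : ℕ) : ℝ) := Finset.sum_nonneg fun _ _ => Nat.cast_nonneg _
  simp only [propRule]
  rw [← Finset.sum_div, hmerge.sum_eq, ← Finset.sum_add_sum_compl T,
    div_le_div_iff₀ (by linarith) (by linarith)]
  nlinarith [mul_le_mul_of_nonneg_right hle hrest]

/-- A convex function on `[0, 1]` vanishing at `0` lies below its chord. -/
theorem ConvexOn.le_mul_of_map_zero {U : ℝ → ℝ} (hU : ConvexOn ℝ (Set.Icc (0 : ℝ) 1) U)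
    (hU0 : U 0 = 0) {t : ℝ} (ht0 : 0 ≤ t) (ht1 : t ≤ 1) : U t ≤ t * U 1 := by
  have := hU.2 (Set.left_mem_Icc.2 zero_le_one) (Set.right_mem_Icc.2 zero_le_one)
    (sub_nonneg.2 ht1) ht0 (sub_add_cancel 1 t)
  simpa [hU0] using this

/-- Theorem 7, risk-seeking miners: the proportional
allocation rule is collusion-proof against the family of all convex utility
functions `U : [0,1] → ℝ≥0` with `U 1 > U 0 = 0`, under arbitrary reward
sharing.  The reward-sharing scheme is a finite-support distribution given by
`K` outcomes with probabilities `w k` and reward shares `r k i` for `i ∈ T`. -/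
theorem propRule_collusionProof_riskSeeking {n m K : ℕ} (hn : 0 < n)
    (Us : Fin n → ℝ → ℝ)
    (hconv : ∀ i, ConvexOn ℝ (Set.Icc (0 : ℝ) 1) (Us i))
    (hnonneg : ∀ i, ∀ t ∈ Set.Icc (0 : ℝ) 1, 0 ≤ Us i t)
    (hzero : ∀ i, Us i 0 = 0) (hone : ∀ i, 0 < Us i 1)
    (h : Fin n → ℕ+) (T : Finset (Fin n)) (h' : Fin m → ℕ+) (istar : Fin m)
    (hmerge : IsMerge h T h' istar)
    (w : Fin K → ℝ) (hw : ∀ k, 0 ≤ w k) (hw1 : ∑ k, w k = 1)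
    (r : Fin K → Fin n → ℝ)
    (hr : ∀ k, ∀ i ∈ T, 0 ≤ r k i) (hr1 : ∀ k, ∑ i ∈ T, r k i ≤ 1) :
    ¬ ((∀ i ∈ T, Us i 1 * propRule.alloc h i ≤
          propRule.alloc h' istar * ∑ k, w k * Us i (r k i)) ∧
       (∃ i ∈ T, Us i 1 * propRule.alloc h i <
          propRule.alloc h' istar * ∑ k, w k * Us i (r k i))) := by
  rintro ⟨hall, i₀, hi₀, hlt⟩
  have hx := propRule.nonneg h' istar
  have hE : ∀ i ∈ T, propRule.alloc h' istar * ∑ k, w k * Us i (r k i) ≤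
      Us i 1 * (propRule.alloc h' istar * ∑ k, w k * r k i) := by
    intro i hi
    rw [mul_left_comm, Finset.mul_sum (a := Us i 1)]
    refine mul_le_mul_of_nonneg_left (Finset.sum_le_sum fun k _ => ?_) hx
    rw [mul_left_comm, mul_comm (Us i 1)]
    have hle : r k i ≤ 1 := (Finset.single_le_sum (hr k) hi).trans (hr1 k)
    exact mul_le_mul_of_nonneg_left
      ((hconv i).le_mul_of_map_zero (hzero i) (hr k i hi) hle) (hw k)
  have hsum : ∑ i ∈ T, propRule.alloc h i <
      ∑ i ∈ T, propRule.alloc h' istar * ∑ k, w k * r k i :=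
    Finset.sum_lt_sum
      (fun i hi => le_of_mul_le_mul_left ((hall i hi).trans (hE i hi)) (hone i))
      ⟨i₀, hi₀, lt_of_mul_lt_mul_left (hlt.trans_le (hE i₀ hi₀)) (hone i₀).le⟩
  have hshare : ∑ i ∈ T, ∑ k, w k * r k i ≤ 1 := by
    rw [Finset.sum_comm, ← hw1]
    refine Finset.sum_le_sum fun k _ => ?_
    rw [← Finset.mul_sum]
    exact mul_le_of_le_one_right (hw k) (hr1 k)
  rw [← Finset.mul_sum] at hsum
  have hproof := collusionProofArbitrary_propRule hn h T h' istar hmerge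
  exact absurd (hsum.trans_le (mul_le_of_le_one_right hx hshare)) hproof.not_gt
end
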